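/- For any margin level γ > 0 and scale s > 0, the surrogate loss φ : ℝ → ℝ defined by φ(u) = s² ρ((γ − u)/s) is convex on ℝ, differentiable at 0, and its derivative at 0 satisfies φ′(0) = −s ψ(γ/s) < 0. (By the Bartlett–Jordan–McAuliffe criterion for convex losses, this means φ is classification-calibrated.) -/

import Mathlib

/-- The Catoni influence function. -/
noncomputable def psi (u : ℝ) : ℝ :=
  if |u| ≤ Real.sqrt 2 then u - u ^ 3 / 6
  else if u > Real.sqrt 2 then 2 * Real.sqrt 2 / 3
  else -(2 * Real.sqrt 2 / 3)

/-- The integrated Catoni loss. -/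
noncomputable def rho (u : ℝ) : ℝ :=
  if |u| ≤ Real.sqrt 2 then u ^ 2 / 2 - u ^ 4 / 24
  else (2 * Real.sqrt 2 / 3) * |u| - 1 / 2

lemma rho_of_mem_Icc {u : ℝ} (hu : u ∈ Set.Icc (-Real.sqrt 2) (Real.sqrt 2)) :
    rho u = u ^ 2 / 2 - u ^ 4 / 24 :=
  if_pos (abs_le.2 hu)

lemma rho_of_sqrt_two_le_abs {u : ℝ} (hu : Real.sqrt 2 ≤ |u|) :
    rho u = (2 * Real.sqrt 2 / 3) * |u| - 1 / 2 := by
  rcases hu.eq_or_lt with h | h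
  · have h2 : Real.sqrt 2 ^ 2 = 2 := Real.sq_sqrt zero_le_two
    have hu2 : u ^ 2 = 2 := by rw [← sq_abs, ← h, h2]
    rw [rho_of_mem_Icc (abs_le.1 h.ge), ← h]
    linear_combination (1 / 2 - (u ^ 2 + 2) / 24) * hu2 - 2 / 3 * h2
  · exact if_neg h.not_ge

lemma psi_of_mem_Icc {u : ℝ} (hu : u ∈ Set.Icc (-Real.sqrt 2) (Real.sqrt 2)) :
    psi u = u - u ^ 3 / 6 :=
  if_pos (abs_le.2 hu)

lemma psi_of_sqrt_two_le {u : ℝ} (hu : Real.sqrt 2 ≤ u) : psi u = 2 * Real.sqrt 2 / 3 := by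
  have h0 : 0 ≤ Real.sqrt 2 := Real.sqrt_nonneg 2
  rcases hu.eq_or_lt with rfl | h
  · rw [psi_of_mem_Icc ⟨by linarith, le_rfl⟩]
    linear_combination (-Real.sqrt 2 / 6) * Real.sq_sqrt (zero_le_two (α := ℝ))
  · rw [psi, if_neg (by rw [abs_of_nonneg (h0.trans hu)]; exact h.not_ge), if_pos h]

lemma psi_neg (u : ℝ) : psi (-u) = -psi u := by
  have h0 : 0 ≤ Real.sqrt 2 := Real.sqrt_nonneg 2
  unfold psi
  rw [abs_neg]
  split_ifs with h h1 h2 h2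
  · ring
  · linarith
  · ring
  · ring
  · exact absurd (abs_le.2 ⟨by linarith, by linarith⟩) h

lemma psi_of_le_neg_sqrt_two {u : ℝ} (hu : u ≤ -Real.sqrt 2) :
    psi u = -(2 * Real.sqrt 2 / 3) := by
  rw [← neg_neg u, psi_neg, psi_of_sqrt_two_le (le_neg.1 hu)]

lemma psi_monotone : Monotone psi := by
  have h0 : 0 ≤ Real.sqrt 2 := Real.sqrt_nonneg 2
  have h2 : Real.sqrt 2 ^ 2 = 2 := Real.sq_sqrt zero_le_two
  have hmid : MonotoneOn psi (Set.Icc (-Real.sqrt 2) (Real.sqrt 2)) := by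
    intro x hx y hy hxy
    rw [psi_of_mem_Icc hx, psi_of_mem_Icc hy]
    have hx2 : x ^ 2 ≤ 2 := h2 ▸ sq_le_sq' hx.1 hx.2
    have hy2 : y ^ 2 ≤ 2 := h2 ▸ sq_le_sq' hy.1 hy.2
    have hq : 0 ≤ 6 - (x ^ 2 + x * y + y ^ 2) := by nlinarith [sq_nonneg (x - y)]
    nlinarith [mul_nonneg (sub_nonneg.2 hxy) hq]
  have hproj (u : ℝ) : psi u = psi (max (-Real.sqrt 2) (min u (Real.sqrt 2))) := by
    rcases le_total u (Real.sqrt 2) with h | h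
    · rw [min_eq_left h]
      rcases le_total (-Real.sqrt 2) u with h' | h'
      · rw [max_eq_right h']
      · rw [max_eq_left h', psi_of_le_neg_sqrt_two h', psi_of_le_neg_sqrt_two le_rfl]
    · rw [min_eq_right h, max_eq_right (by linarith), psi_of_sqrt_two_le h,
        psi_of_sqrt_two_le le_rfl]
  have hmem (u : ℝ) : max (-Real.sqrt 2) (min u (Real.sqrt 2)) ∈
      Set.Icc (-Real.sqrt 2) (Real.sqrt 2) :=
    ⟨le_max_left _ _, max_le (by linarith) (min_le_right _ _)⟩
  intro x y hxy
  rw [hproj x, hproj y]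
  exact hmid (hmem x) (hmem y) (max_le_max_left _ (min_le_min_right _ hxy))

lemma psi_pos {u : ℝ} (hu : 0 < u) : 0 < psi u := by
  have h2 : Real.sqrt 2 ^ 2 = 2 := Real.sq_sqrt zero_le_two
  rcases le_total u (Real.sqrt 2) with h | h
  · have hu2 : u ^ 2 ≤ 2 := h2 ▸ pow_le_pow_left₀ hu.le h 2
    rw [psi_of_mem_Icc ⟨by linarith, h⟩]
    nlinarith [mul_pos hu (show 0 < 6 - u ^ 2 by linarith)]
  · rw [psi_of_sqrt_two_le h]
    positivity

lemma hasDerivWithinAt_of_eqOn_isClosed {f f' g : ℝ → ℝ} {S : Set ℝ} (hS : IsClosed S)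
    (hfg : Set.EqOn f g S) (hg : ∀ u ∈ S, HasDerivAt g (f' u) u) (u : ℝ) :
    HasDerivWithinAt f (f' u) S u := by
  by_cases hu : u ∈ S
  · exact (hg u hu).hasDerivWithinAt.congr hfg (hfg hu)
  · exact HasFDerivWithinAt.of_notMem_closure (by rwa [hS.closure_eq])

lemma hasDerivAt_rho (u : ℝ) : HasDerivAt rho (psi u) u := by
  have h0 : 0 ≤ Real.sqrt 2 := Real.sqrt_nonneg 2
  have hmid : HasDerivWithinAt rho (psi u) (Set.Icc (-Real.sqrt 2) (Real.sqrt 2)) u := by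
    refine hasDerivWithinAt_of_eqOn_isClosed isClosed_Icc (fun v hv => rho_of_mem_Icc hv)
      (fun v hv => ?_) u
    rw [psi_of_mem_Icc hv]
    refine (((hasDerivAt_pow 2 v).div_const 2).sub
      ((hasDerivAt_pow 4 v).div_const 24)).congr_deriv ?_
    push_cast
    ring
  have hright : HasDerivWithinAt rho (psi u) (Set.Ici (Real.sqrt 2)) u := by
    refine hasDerivWithinAt_of_eqOn_isClosed (g := fun v => 2 * Real.sqrt 2 / 3 * v - 1 / 2)
      isClosed_Ici (fun v hv => ?_) (fun v hv => ?_) u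
    · have hv' : |v| = v := abs_of_nonneg (h0.trans hv)
      rw [rho_of_sqrt_two_le_abs (hv'.symm ▸ hv), hv']
    · rw [psi_of_sqrt_two_le hv]
      simpa using ((hasDerivAt_id v).const_mul (2 * Real.sqrt 2 / 3)).sub_const (1 / 2)
  have hleft : HasDerivWithinAt rho (psi u) (Set.Iic (-Real.sqrt 2)) u := by
    refine hasDerivWithinAt_of_eqOn_isClosed (g := fun v => -(2 * Real.sqrt 2 / 3) * v - 1 / 2)
      isClosed_Iic (fun v hv => ?_) (fun v hv => ?_) u
    · have hv' : |v| = -v := abs_of_nonpos (le_trans hv (neg_nonpos.2 h0))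
      rw [rho_of_sqrt_two_le_abs (hv'.symm ▸ le_neg.1 hv), hv']
      ring
    · rw [psi_of_le_neg_sqrt_two hv]
      simpa using ((hasDerivAt_id v).const_mul (-(2 * Real.sqrt 2 / 3))).sub_const (1 / 2)
  rw [← hasDerivWithinAt_univ, ← Set.Iic_union_Ici (a := Real.sqrt 2),
    ← Set.Iic_union_Icc_eq_Iic (show -Real.sqrt 2 ≤ Real.sqrt 2 by linarith)]
  exact (hleft.union hmid).union hright

lemma hasDerivAt_surrogate_loss (γ : ℝ) {s : ℝ} (hs : s ≠ 0) (u : ℝ) :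
    HasDerivAt (fun u : ℝ => s ^ 2 * rho ((γ - u) / s)) (-(s * psi ((γ - u) / s))) u := by
  refine (((hasDerivAt_rho ((γ - u) / s)).comp u
    (((hasDerivAt_id u).const_sub γ).div_const s)).const_mul (s ^ 2)).congr_deriv ?_
  field_simp

/-- The surrogate loss `φ(u) = s²ρ((γ - u)/s)` is convex, differentiable at `0`, and
`φ′(0) = -sψ(γ/s) < 0`, hence (by the Bartlett–Jordan–McAuliffe criterion) the loss
is classification-calibrated. -/
theorem surrogate_loss_convex_calibrated (γ s : ℝ) (hγ : 0 < γ) (hs : 0 < s) :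
    ConvexOn ℝ Set.univ (fun u : ℝ => s ^ 2 * rho ((γ - u) / s)) ∧
      HasDerivAt (fun u : ℝ => s ^ 2 * rho ((γ - u) / s)) (-(s * psi (γ / s))) 0 ∧
      -(s * psi (γ / s)) < 0 := by
  have hderiv := hasDerivAt_surrogate_loss γ hs.ne'
  refine ⟨?_, by simpa using hderiv 0, neg_lt_zero.2 (mul_pos hs (psi_pos (div_pos hγ hs)))⟩
  refine Monotone.convexOn_univ_of_deriv (fun u => (hderiv u).differentiableAt) ?_
  intro x y hxy
  rw [(hderiv x).deriv, (hderiv y).deriv]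
  exact neg_le_neg (mul_le_mul_of_nonneg_left (psi_monotone (by gcongr)) hs.le)
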